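/- Let p ≥ 5 be a prime and let I₁ be the pro-p Iwahori subgroup of SL₂(ℤ_p), i.e. the subgroup of matrices A ∈ SL₂(ℤ_p) with A₀₀ − 1 ∈ pℤ_p, A₁₁ − 1 ∈ pℤ_p and A₁₀ ∈ pℤ_p. Then for every b ∈ ℤ_p the matrix !![1, p·b; 0, 1] lies in the commutator subgroup of I₁, and for every c ∈ ℤ_p the matrix !![1, 0; p²·c, 1] lies in the commutator subgroup of I₁. -/

import Mathlib

open Matrix

/-- The pro-`p` Iwahori subgroup of `SL₂(ℤ_p)`: matrices that are upper-triangular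
unipotent mod `p`. -/
def proPIwahori (p : ℕ) [Fact p.Prime] : Subgroup (Matrix.SpecialLinearGroup (Fin 2) ℤ_[p]) where
  carrier := {A | (p : ℤ_[p]) ∣ ((A : Matrix (Fin 2) (Fin 2) ℤ_[p]) 0 0 - 1) ∧
    (p : ℤ_[p]) ∣ ((A : Matrix (Fin 2) (Fin 2) ℤ_[p]) 1 1 - 1) ∧
    (p : ℤ_[p]) ∣ ((A : Matrix (Fin 2) (Fin 2) ℤ_[p]) 1 0)}
  one_mem' := by
    simp [Matrix.SpecialLinearGroup.coe_one, Matrix.one_apply]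
  mul_mem' := by
    rintro A B ⟨hA1, hA2, hA3⟩ ⟨hB1, hB2, hB3⟩
    simp only [Set.mem_setOf_eq, Matrix.SpecialLinearGroup.coe_mul, Matrix.mul_apply,
      Fin.sum_univ_two] at *
    refine ⟨?_, ?_, ?_⟩
    · have h : (A : Matrix (Fin 2) (Fin 2) ℤ_[p]) 0 0 * (B : Matrix (Fin 2) (Fin 2) ℤ_[p]) 0 0 +
          (A : Matrix (Fin 2) (Fin 2) ℤ_[p]) 0 1 * (B : Matrix (Fin 2) (Fin 2) ℤ_[p]) 1 0 - 1 =
          ((A : Matrix (Fin 2) (Fin 2) ℤ_[p]) 0 0 - 1) * (B : Matrix (Fin 2) (Fin 2) ℤ_[p]) 0 0 +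
          ((B : Matrix (Fin 2) (Fin 2) ℤ_[p]) 0 0 - 1) +
          (A : Matrix (Fin 2) (Fin 2) ℤ_[p]) 0 1 * (B : Matrix (Fin 2) (Fin 2) ℤ_[p]) 1 0 := by
        ring
      rw [h]
      exact dvd_add (dvd_add (hA1.mul_right _) hB1) (hB3.mul_left _)
    · have h : (A : Matrix (Fin 2) (Fin 2) ℤ_[p]) 1 0 * (B : Matrix (Fin 2) (Fin 2) ℤ_[p]) 0 1 +
          (A : Matrix (Fin 2) (Fin 2) ℤ_[p]) 1 1 * (B : Matrix (Fin 2) (Fin 2) ℤ_[p]) 1 1 - 1 =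
          (A : Matrix (Fin 2) (Fin 2) ℤ_[p]) 1 0 * (B : Matrix (Fin 2) (Fin 2) ℤ_[p]) 0 1 +
          ((A : Matrix (Fin 2) (Fin 2) ℤ_[p]) 1 1 - 1) * (B : Matrix (Fin 2) (Fin 2) ℤ_[p]) 1 1 +
          ((B : Matrix (Fin 2) (Fin 2) ℤ_[p]) 1 1 - 1) := by
        ring
      rw [h]
      exact dvd_add (dvd_add (hA3.mul_right _) (hA2.mul_right _)) hB2
    · exact dvd_add (hA3.mul_right _) (hB3.mul_left _)
  inv_mem' := by
    rintro A ⟨hA1, hA2, hA3⟩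
    rw [Matrix.SpecialLinearGroup.SL2_inv_expl]
    refine ⟨?_, ?_, ?_⟩ <;> simp [hA1, hA2, hA3]

namespace Matrix.SpecialLinearGroup

variable {R : Type*} [CommRing R]

/-- The matrix `!![a, 0; 0, d]` with `a * d = 1`, as an element of `SL₂(R)`. -/
def diagTwo {a d : R} (h : a * d = 1) : SpecialLinearGroup (Fin 2) R :=
  ⟨!![a, 0; 0, d], by simpa [det_fin_two_of] using h⟩

/-- The upper unipotent matrix `!![1, y; 0, 1]`, as an element of `SL₂(R)`. -/
def upperTwo (y : R) : SpecialLinearGroup (Fin 2) R :=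
  ⟨!![1, y; 0, 1], by simp [det_fin_two_of]⟩

/-- The lower unipotent matrix `!![1, 0; z, 1]`, as an element of `SL₂(R)`. -/
def lowerTwo (z : R) : SpecialLinearGroup (Fin 2) R :=
  ⟨!![1, 0; z, 1], by simp [det_fin_two_of]⟩

open scoped commutatorElement in
theorem commutatorElement_diagTwo_upperTwo {a d : R} (h : a * d = 1) (y : R) :
    ⁅diagTwo h, upperTwo y⁆ = upperTwo ((a ^ 2 - 1) * y) := by
  rw [commutatorElement_def, mul_inv_eq_iff_eq_mul, mul_inv_eq_iff_eq_mul]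
  ext i j
  fin_cases i <;> fin_cases j <;>
    simp only [coe_mul] <;> simp [diagTwo, upperTwo]
  linear_combination (-(a * y)) * h

open scoped commutatorElement in
theorem commutatorElement_diagTwo_lowerTwo {a d : R} (h : a * d = 1) (z : R) :
    ⁅diagTwo h, lowerTwo z⁆ = lowerTwo ((d ^ 2 - 1) * z) := by
  rw [commutatorElement_def, mul_inv_eq_iff_eq_mul, mul_inv_eq_iff_eq_mul]
  ext i j
  fin_cases i <;> fin_cases j <;>
    simp only [coe_mul] <;> simp [diagTwo, lowerTwo]
  linear_combination (-(d * z)) * h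

end Matrix.SpecialLinearGroup

/-- A natural number coprime to `p` has an inverse in `ℤ_[p]`. -/
theorem PadicInt.exists_natCast_mul_eq_one {p : ℕ} [Fact p.Prime] {n : ℕ} (h : ¬ p ∣ n) :
    ∃ v : ℤ_[p], (n : ℤ_[p]) * v = 1 := by
  refine IsUnit.exists_right_inv (PadicInt.isUnit_iff.2 ?_)
  refine le_antisymm (PadicInt.norm_le_one _) (not_lt.1 fun hlt => h ?_)
  have := (PadicInt.norm_int_lt_one_iff_dvd (p := p) (n : ℤ)).1 (by simpa using hlt)
  exact_mod_cast this

/-- Step (a) of the proof of Lemma 5.1 of the paper, for `SL₂(ℚ_p)`: the upper-unipotent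
matrices `!![1, p·b; 0, 1]` and lower-unipotent matrices `!![1, 0; p²·c, 1]` lie in the
commutator subgroup of the pro-`p` Iwahori subgroup `I₁`. -/
theorem unipotent_mem_commutator_proPIwahori (p : ℕ) [Fact p.Prime] (hp : 5 ≤ p) :
    (∀ b : ℤ_[p],
      (⟨!![1, (p : ℤ_[p]) * b; 0, 1], by simp [Matrix.det_fin_two_of]⟩ :
        Matrix.SpecialLinearGroup (Fin 2) ℤ_[p]) ∈ ⁅proPIwahori p, proPIwahori p⁆) ∧
    (∀ c : ℤ_[p],
      (⟨!![1, 0; (p : ℤ_[p]) ^ 2 * c, 1], by simp [Matrix.det_fin_two_of]⟩ :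
        Matrix.SpecialLinearGroup (Fin 2) ℤ_[p]) ∈ ⁅proPIwahori p, proPIwahori p⁆) := by
  have h1 : ¬ p ∣ 1 + p := fun h => by
    have := Nat.le_of_dvd one_pos ((Nat.dvd_add_left dvd_rfl).1 h)
    omega
  have h2 : ¬ p ∣ 2 + p := fun h => by
    have := Nat.le_of_dvd two_pos ((Nat.dvd_add_left dvd_rfl).1 h)
    omega
  obtain ⟨d, hd⟩ := PadicInt.exists_natCast_mul_eq_one h1
  obtain ⟨v, hv⟩ := PadicInt.exists_natCast_mul_eq_one h2
  push_cast at hd hv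
  have ht : SpecialLinearGroup.diagTwo hd ∈ proPIwahori p := by
    refine ⟨⟨1, by simp [SpecialLinearGroup.diagTwo]⟩, ⟨-d, ?_⟩,
      by simp [SpecialLinearGroup.diagTwo]⟩
    change d - 1 = p * -d
    linear_combination hd
  refine ⟨fun b => ?_, fun c => ?_⟩
  · change SpecialLinearGroup.upperTwo (p * b) ∈ _
    have hu : SpecialLinearGroup.upperTwo (v * b) ∈ proPIwahori p := by
      refine ⟨?_, ?_, ?_⟩ <;> simp [SpecialLinearGroup.upperTwo]
    have e : p * b = ((1 + (p : ℤ_[p])) ^ 2 - 1) * (v * b) := by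
      linear_combination (-(p : ℤ_[p]) * b) * hv
    rw [e, ← SpecialLinearGroup.commutatorElement_diagTwo_upperTwo hd]
    exact Subgroup.commutator_mem_commutator ht hu
  · change SpecialLinearGroup.lowerTwo ((p : ℤ_[p]) ^ 2 * c) ∈ _
    have hl : SpecialLinearGroup.lowerTwo ((1 + (p : ℤ_[p])) ^ 2 * v * -(p * c)) ∈
        proPIwahori p := by
      refine ⟨?_, ?_, ?_⟩ <;> simp [SpecialLinearGroup.lowerTwo, dvd_mul_of_dvd_right]
    have e : (p : ℤ_[p]) ^ 2 * c = (d ^ 2 - 1) * ((1 + p) ^ 2 * v * -(p * c)) := by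
      linear_combination (-(p : ℤ_[p]) ^ 2 * c) * hv +
        (p * c * v * ((1 + p) * d + 1)) * hd
    rw [e, ← SpecialLinearGroup.commutatorElement_diagTwo_lowerTwo hd]
    exact Subgroup.commutator_mem_commutator ht hl
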